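/- There is an absolute constant C such that for every Schwartz function f : ℝ⁴ → ℂ one has the weighted radial–spherical Sobolev estimate ∫_0^∞ ( ∫_{S³} |f(rθ)|⁶ dσ(θ) )^{1/3} r³ dr ≤ C ( ‖f‖_{L²(ℝ⁴)}² + Σ_{1≤i<j≤4} ‖Ω_{ij} f‖_{L²(ℝ⁴)}² ). -/

import Mathlib

open MeasureTheory
open scoped ENNReal BigOperators

noncomputable section

/-- Four-dimensional Euclidean space. -/
abbrev Sp : Type := EuclideanSpace ℝ (Fin 4)

/-- The canonical surface measure `σ` on the unit sphere `S³ ⊂ ℝ⁴`. -/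
def sphMeasure : Measure (Metric.sphere (0 : Sp) 1) :=
  (volume : Measure Sp).toSphere

/-- The angular momentum (rotation) vector fields `Ω_{ij}f(x) = x_i ∂_j f − x_j ∂_i f`. -/
def Omega (i j : Fin 4) (f : Sp → ℂ) (x : Sp) : ℂ :=
  (x i : ℂ) * fderiv ℝ f x (EuclideanSpace.single j (1:ℝ))
    - (x j : ℂ) * fderiv ℝ f x (EuclideanSpace.single i (1:ℝ))

instance : SFinite sphMeasure := inferInstanceAs (SFinite (volume : Measure Sp).toSphere)

/-- Integration in polar coordinates on `ℝ⁴`. -/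
lemma lintegral_eq_lintegral_polar {F : Sp → ℝ≥0∞} (hF : Measurable F) :
    ∫⁻ x, F x = ∫⁻ r in Set.Ioi (0:ℝ),
      (∫⁻ θ : Metric.sphere (0 : Sp) 1, F (r • (θ : Sp)) ∂sphMeasure) * ENNReal.ofReal (r ^ 3) := by
  have hG : Measurable fun p : Metric.sphere (0 : Sp) 1 × Set.Ioi (0:ℝ) =>
      F ((p.2 : ℝ) • (p.1 : Sp)) := by fun_prop
  have hH : Measurable fun r : ℝ =>
      ∫⁻ θ : Metric.sphere (0 : Sp) 1, F (r • (θ : Sp)) ∂sphMeasure :=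
    Measurable.lintegral_prod_left' (f := fun p : Metric.sphere (0 : Sp) 1 × ℝ =>
      F (p.2 • (p.1 : Sp))) (by fun_prop)
  calc ∫⁻ x, F x = ∫⁻ x : ({(0)}ᶜ : Set Sp), F x.1 ∂((volume : Measure Sp).comap (↑)) := by
        rw [lintegral_subtype_comap (measurableSet_singleton _).compl F,
          restrict_compl_singleton]
    _ = ∫⁻ p, F ((p.2 : ℝ) • (p.1 : Sp)) ∂(volume : Measure Sp).toSphere.prod
          (Measure.volumeIoiPow (Module.finrank ℝ Sp - 1)) := by
        rw [← (volume : Measure Sp).measurePreserving_homeomorphUnitSphereProd.lintegral_comp hG]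
        refine lintegral_congr fun x => ?_
        have hx : ‖(x : Sp)‖ ≠ 0 := norm_ne_zero_iff.2 x.2
        simp [smul_smul, hx]
    _ = ∫⁻ r : Set.Ioi (0:ℝ), (∫⁻ θ : Metric.sphere (0 : Sp) 1, F ((r : ℝ) • (θ : Sp))
          ∂sphMeasure) ∂(Measure.volumeIoiPow (Module.finrank ℝ Sp - 1)) := by
        rw [lintegral_prod_symm _ hG.aemeasurable]
        rfl
    _ = _ := by
        rw [Measure.volumeIoiPow, ← lintegral_subtype_comap measurableSet_Ioi]
        refine (lintegral_withDensity_eq_lintegral_mul _ (by fun_prop)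
          (hH.comp measurable_subtype_coe)).trans ?_
        refine lintegral_congr fun x => ?_
        simp [mul_comm]

lemma lintegral_Ioo_cube {a : ℝ} (ha : 0 < a) :
    ∫⁻ t in Set.Ioi (0:ℝ), (Set.Ioo (1:ℝ) 2).indicator 1 (t * a) * ENNReal.ofReal (t ^ 3)
      = ENNReal.ofReal (15 / 4 * a⁻¹ ^ 4) := by
  have h1 : ∀ t : ℝ, (Set.Ioo (1:ℝ) 2).indicator (1 : ℝ → ℝ≥0∞) (t * a) * ENNReal.ofReal (t ^ 3)
      = (Set.Ioo (1 / a) (2 / a)).indicator (fun t => ENNReal.ofReal (t ^ 3)) t := by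
    intro t
    simp only [Set.indicator_apply, Set.mem_Ioo, div_lt_iff₀ ha, lt_div_iff₀ ha, Pi.one_apply,
      ite_mul, one_mul, zero_mul]
  have hle : 1 / a ≤ 2 / a := by gcongr; norm_num
  have h0 : 0 < 1 / a := by positivity
  have hsub : Set.Ioo (1 / a) (2 / a) ⊆ Set.Ioi 0 := fun x hx => h0.trans hx.1
  simp_rw [h1]
  rw [lintegral_indicator measurableSet_Ioo, Measure.restrict_restrict measurableSet_Ioo,
    Set.inter_eq_left.2 hsub, restrict_Ioo_eq_restrict_Ioc,
    ← ofReal_integral_eq_lintegral_ofReal, ← intervalIntegral.integral_of_le hle, integral_pow]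
  · congr 1
    rw [div_pow, div_pow]
    field_simp
    ring
  · exact (intervalIntegral.intervalIntegrable_pow 3).1
  · filter_upwards [ae_restrict_mem measurableSet_Ioc] with y hy
    exact pow_nonneg (h0.trans hy.1).le _

/-- The integral of a function over the sphere is, up to a factor, the integral of its
homogeneous extension over a spherical shell. -/
lemma lintegral_shell {h : Sp → ℝ≥0∞} (hh : Measurable h) :
    ∫⁻ x : Sp, h (‖x‖⁻¹ • x) * (Set.Ioo (1:ℝ) 2).indicator 1 ‖x‖ =
      (∫⁻ θ : Metric.sphere (0 : Sp) 1, h θ ∂sphMeasure) * ENNReal.ofReal (15 / 4) := by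
  have hi : Measurable ((Set.Ioo (1:ℝ) 2).indicator (1 : ℝ → ℝ≥0∞)) :=
    measurable_one.indicator measurableSet_Ioo
  have hm : Measurable fun x : Sp => h (‖x‖⁻¹ • x) * (Set.Ioo (1:ℝ) 2).indicator 1 ‖x‖ :=
    (hh.comp (by fun_prop)).mul (hi.comp measurable_norm)
  have h15 := lintegral_Ioo_cube one_pos
  simp only [inv_one, one_pow, mul_one] at h15
  rw [lintegral_eq_lintegral_polar hm, ← h15, ← lintegral_const_mul _ (by fun_prop)]
  refine setLIntegral_congr_fun measurableSet_Ioi fun r (hr : 0 < r) => ?_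
  have key : ∀ θ : Metric.sphere (0 : Sp) 1, ‖r • (θ : Sp)‖ = r := by
    intro θ; simp [norm_smul, abs_of_pos hr]
  simp only [key, smul_smul, inv_mul_cancel₀ hr.ne', one_smul]
  rw [lintegral_mul_const _ (by fun_prop), mul_assoc]

lemma lintegral_sphere_neg {h : Sp → ℝ≥0∞} (hh : Measurable h) :
    ∫⁻ θ : Metric.sphere (0 : Sp) 1, h (-θ) ∂sphMeasure =
      ∫⁻ θ : Metric.sphere (0 : Sp) 1, h θ ∂sphMeasure := by
  have h1 := lintegral_shell hh
  rw [← lintegral_neg_eq_self] at h1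
  have h2 := lintegral_shell (h := fun x => h (-x)) (hh.comp measurable_neg)
  simp only [norm_neg, smul_neg] at h1
  rw [h1] at h2
  exact ((ENNReal.mul_left_inj (by norm_num) (by simp)).1 h2).symm

/-- The tangent hyperplane `{x | x k = 1}` of the unit sphere, parametrised by `ℝ³`. -/
def tangentPlane (k : Fin 4) (y : Fin 3 → ℝ) : Sp := WithLp.toLp 2 (k.insertNth 1 y)

lemma tangentPlane_apply_self (k : Fin 4) (y : Fin 3 → ℝ) : tangentPlane k y k = 1 := by
  simp [tangentPlane]

lemma tangentPlane_apply_succAbove (k : Fin 4) (y : Fin 3 → ℝ) (j : Fin 3) :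
    tangentPlane k y (k.succAbove j) = y j := by
  simp [tangentPlane]

lemma one_le_norm_tangentPlane (k : Fin 4) (y : Fin 3 → ℝ) : 1 ≤ ‖tangentPlane k y‖ := by
  simpa [tangentPlane_apply_self] using PiLp.norm_apply_le (tangentPlane k y) k

lemma norm_tangentPlane_pos (k : Fin 4) (y : Fin 3 → ℝ) : 0 < ‖tangentPlane k y‖ :=
  one_pos.trans_le (one_le_norm_tangentPlane k y)

lemma norm_le_norm_tangentPlane (k : Fin 4) (y : Fin 3 → ℝ) : ‖y‖ ≤ ‖tangentPlane k y‖ := by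
  refine (pi_norm_le_iff_of_nonneg (norm_nonneg _)).2 fun j => ?_
  simpa [tangentPlane_apply_succAbove] using PiLp.norm_apply_le (tangentPlane k y) (k.succAbove j)

lemma measurable_insertNth (k : Fin 4) :
    Measurable fun p : ℝ × (Fin 3 → ℝ) => (WithLp.toLp 2 (k.insertNth p.1 p.2) : Sp) :=
  (WithLp.measurable_toLp 2 (Fin 4 → ℝ)).comp
    (MeasurableEquiv.piFinSuccAbove (fun _ : Fin 4 => ℝ) k).symm.measurable

lemma measurable_tangentPlane (k : Fin 4) : Measurable (tangentPlane k) :=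
  (measurable_insertNth k).comp measurable_prodMk_left

lemma lintegral_eq_lintegral_insertNth (k : Fin 4) {F : Sp → ℝ≥0∞} (hF : Measurable F) :
    ∫⁻ x, F x = ∫⁻ t : ℝ, ∫⁻ y : Fin 3 → ℝ, F (WithLp.toLp 2 (k.insertNth t y)) := by
  have e1 := (PiLp.volume_preserving_toLp (Fin 4)).lintegral_comp hF
  have e2 := ((volume_preserving_piFinSuccAbove (fun _ : Fin 4 => ℝ) k).symm _).lintegral_comp
    (f := fun x => F (WithLp.toLp 2 x)) (by fun_prop)
  rw [← e1, ← e2, Measure.volume_eq_prod, lintegral_prod]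
  · rfl
  · exact (hF.comp (measurable_insertNth k)).aemeasurable

lemma lintegral_comp_smul_pi {F : (Fin 3 → ℝ) → ℝ≥0∞} (hF : Measurable F) {t : ℝ} (ht : 0 < t) :
    ∫⁻ y, F y = ∫⁻ y, ENNReal.ofReal (t ^ 3) * F (t • y) := by
  rw [lintegral_const_mul _ (by fun_prop),
    ← lintegral_map hF (by fun_prop : Measurable fun y : Fin 3 → ℝ => t • y),
    Measure.map_addHaar_smul _ ht.ne', lintegral_smul_measure, smul_eq_mul, ← mul_assoc,
    ← ENNReal.ofReal_mul (by positivity)]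
  simp [abs_of_pos ht, ht.ne']

/-- Change of variables for the gnomonic projection. -/
lemma lintegral_gnomonic (k : Fin 4) {h : Sp → ℝ≥0∞} (hh : Measurable h) :
    ∫⁻ y, h (‖tangentPlane k y‖⁻¹ • tangentPlane k y) *
        ENNReal.ofReal (‖tangentPlane k y‖⁻¹ ^ 4) =
      ∫⁻ θ : Metric.sphere (0 : Sp) 1, {x : Sp | 0 < x k}.indicator h θ ∂sphMeasure := by
  have hi : Measurable ((Set.Ioo (1:ℝ) 2).indicator (1 : ℝ → ℝ≥0∞)) :=
    measurable_one.indicator measurableSet_Ioo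
  have hT := measurable_tangentPlane k
  have hS : MeasurableSet {x : Sp | 0 < x k} := measurableSet_lt measurable_const (by fun_prop)
  have hhS := hh.indicator hS
  refine (ENNReal.mul_left_inj (c := ENNReal.ofReal (15 / 4)) (by norm_num) (by simp)).1 ?_
  have hF : Measurable fun x : Sp => {x : Sp | 0 < x k}.indicator h (‖x‖⁻¹ • x) *
      (Set.Ioo (1:ℝ) 2).indicator 1 ‖x‖ :=
    (hhS.comp (by fun_prop)).mul (hi.comp measurable_norm)
  have hN : Measurable fun y => h (‖tangentPlane k y‖⁻¹ • tangentPlane k y) :=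
    hh.comp (by fun_prop)
  rw [← lintegral_shell hhS, lintegral_eq_lintegral_insertNth k hF]
  have step : ∀ t : ℝ, (∫⁻ y : Fin 3 → ℝ, {x : Sp | 0 < x k}.indicator h
      (‖(WithLp.toLp 2 (k.insertNth t y) : Sp)‖⁻¹ • (WithLp.toLp 2 (k.insertNth t y) : Sp)) *
      (Set.Ioo (1:ℝ) 2).indicator 1 ‖(WithLp.toLp 2 (k.insertNth t y) : Sp)‖) =
      (Set.Ioi 0).indicator (fun t => ∫⁻ y, h (‖tangentPlane k y‖⁻¹ • tangentPlane k y) *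
        ((Set.Ioo (1:ℝ) 2).indicator 1 (t * ‖tangentPlane k y‖) * ENNReal.ofReal (t ^ 3))) t := by
    intro t
    rcases le_or_gt t 0 with ht | ht
    · rw [Set.indicator_of_notMem (by simpa using ht)]
      refine (lintegral_congr fun y => ?_).trans lintegral_zero
      rw [Set.indicator_of_notMem, zero_mul]
      simp only [Set.mem_ofPred_eq, PiLp.smul_apply, Fin.insertNth_apply_same, smul_eq_mul, not_lt]
      exact mul_nonpos_of_nonneg_of_nonpos (by positivity) ht
    · rw [Set.indicator_of_mem (by simpa using ht)]
      refine (lintegral_comp_smul_pi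
        (hF.comp ((measurable_insertNth k).comp measurable_prodMk_left)) ht).trans ?_
      refine lintegral_congr fun y => ?_
      have e : (WithLp.toLp 2 (k.insertNth t (t • y)) : Sp) = t • tangentPlane k y := by
        ext i
        refine Fin.succAboveCases k ?_ (fun j => ?_) i <;> simp [tangentPlane]
      have hp := norm_tangentPlane_pos k y
      simp only [Function.comp_apply]
      rw [e, norm_smul, Real.norm_of_nonneg ht.le, smul_smul, mul_inv, mul_right_comm,
        inv_mul_cancel₀ ht.ne', one_mul, Set.indicator_of_mem]
      · ring
      · simp [tangentPlane_apply_self, hp]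
  simp_rw [step]
  rw [lintegral_indicator measurableSet_Ioi, lintegral_lintegral_swap (Measurable.aemeasurable
    (by fun_prop)), ← lintegral_mul_const _ (by fun_prop)]
  refine lintegral_congr fun y => ?_
  rw [lintegral_const_mul _ (by fun_prop), lintegral_Ioo_cube (norm_tangentPlane_pos k y),
    mul_comm (15 / 4 : ℝ), ENNReal.ofReal_mul (by positivity), mul_assoc]

/-- The linear part of `tangentPlane k`. -/
def tangentEmbedding (k : Fin 4) : (Fin 3 → ℝ) →L[ℝ] Sp :=
  LinearMap.toContinuousLinearMap
    { toFun := fun y => WithLp.toLp 2 (k.insertNth 0 y)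
      map_add' := fun y z => by
        ext i
        refine Fin.succAboveCases k ?_ (fun j => ?_) i <;> simp
      map_smul' := fun c y => by
        ext i
        refine Fin.succAboveCases k ?_ (fun j => ?_) i <;> simp }

lemma tangentPlane_eq (k : Fin 4) (y : Fin 3 → ℝ) :
    tangentPlane k y = EuclideanSpace.single k 1 + tangentEmbedding k y := by
  ext i
  refine Fin.succAboveCases k ?_ (fun j => ?_) i <;> simp [tangentPlane, tangentEmbedding]

lemma norm_tangentEmbedding_le (k : Fin 4) (y : Fin 3 → ℝ) :
    ‖tangentEmbedding k y‖ ≤ 2 * ‖y‖ := by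
  rw [EuclideanSpace.norm_eq, Real.sqrt_le_left (by positivity), Fin.sum_univ_succAbove _ k]
  have h : ∀ j, ‖y j‖ ^ 2 ≤ ‖y‖ ^ 2 := fun j => by gcongr; exact norm_le_pi_norm y j
  simp only [tangentEmbedding, LinearMap.coe_toContinuousLinearMap', LinearMap.coe_mk,
    AddHom.coe_mk, Fin.insertNth_apply_same, Fin.insertNth_apply_succAbove, Fin.sum_univ_three,
    norm_zero]
  nlinarith [h 0, h 1, h 2, sq_nonneg ‖y‖]

lemma norm_tangentPlane_le (k : Fin 4) (y : Fin 3 → ℝ) : ‖tangentPlane k y‖ ≤ 1 + 2 * ‖y‖ := by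
  rw [tangentPlane_eq]
  refine (norm_add_le _ _).trans (add_le_add (by simp) (norm_tangentEmbedding_le k y))

/-- The sum of the squared moduli of a function and of its angular derivatives. -/
def angularEnergy (f : Sp → ℂ) (x : Sp) : ℝ :=
  ‖f x‖ ^ 2 + ∑ i : Fin 4, ∑ j : Fin 4, if i < j then ‖Omega i j f x‖ ^ 2 else 0

lemma angularEnergy_nonneg (f : Sp → ℂ) (x : Sp) : 0 ≤ angularEnergy f x := by
  refine add_nonneg (by positivity) (Finset.sum_nonneg fun i _ => Finset.sum_nonneg fun j _ => ?_)
  split_ifs <;> positivity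

lemma norm_le_sqrt_angularEnergy (f : Sp → ℂ) (x : Sp) : ‖f x‖ ≤ √(angularEnergy f x) := by
  refine Real.le_sqrt_of_sq_le (le_add_of_nonneg_right ?_)
  refine Finset.sum_nonneg fun i _ => Finset.sum_nonneg fun j _ => ?_
  split_ifs <;> positivity

lemma norm_Omega_le_sqrt_angularEnergy (f : Sp → ℂ) (x : Sp) (i j : Fin 4) :
    ‖Omega i j f x‖ ≤ √(angularEnergy f x) := by
  have hlt : ∀ i j : Fin 4, i < j → ‖Omega i j f x‖ ≤ √(angularEnergy f x) := by
    intro i j hij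
    refine Real.le_sqrt_of_sq_le (le_add_of_nonneg_of_le (by positivity) ?_)
    have hn : ∀ i j : Fin 4, 0 ≤ if i < j then ‖Omega i j f x‖ ^ 2 else 0 := fun i j => by
      split_ifs <;> positivity
    have h1 := Finset.single_le_sum (f := fun j => if i < j then ‖Omega i j f x‖ ^ 2 else 0)
      (fun j _ => hn i j) (Finset.mem_univ j)
    have h2 := Finset.single_le_sum
      (f := fun i => ∑ j : Fin 4, if i < j then ‖Omega i j f x‖ ^ 2 else 0)
      (fun i _ => Finset.sum_nonneg fun j _ => hn i j) (Finset.mem_univ i)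
    simp only [hij, if_true] at h1
    exact h1.trans h2
  rcases lt_trichotomy i j with h | rfl | h
  · exact hlt i j h
  · simp [Omega, Real.sqrt_nonneg]
  · rw [show Omega i j f x = -Omega j i f x by simp only [Omega]; ring, norm_neg]
    exact hlt j i h

/-- Tangential derivatives are combinations of angular derivatives. -/
lemma norm_sq_mul_fderiv (f : Sp → ℂ) {x w : Sp} (hw : inner ℝ x w = 0) :
    ((‖x‖ ^ 2 : ℝ) : ℂ) * fderiv ℝ f x w = ∑ i, ∑ j, ((x i * w j : ℝ) : ℂ) * Omega i j f x := by
  have h1 : w = ∑ j, w j • (EuclideanSpace.single j (1:ℝ) : Sp) := by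
    ext i; simp [Finset.sum_apply, Pi.single_apply]
  have h2 : fderiv ℝ f x w = ∑ j, (w j : ℂ) * fderiv ℝ f x (EuclideanSpace.single j (1:ℝ)) := by
    conv_lhs => rw [h1]
    simp
  have h3 : ∑ i, (x i : ℂ) * (w i : ℂ) = 0 := by
    rw [PiLp.inner_apply] at hw
    have := congrArg (fun t : ℝ => (t : ℂ)) hw
    simpa [mul_comm] using this
  rw [h2, EuclideanSpace.norm_sq_eq]
  generalize hD : fderiv ℝ f x = D
  have h4 : (∑ i, (x i : ℂ) * D (EuclideanSpace.single i 1)) * ∑ i, (x i : ℂ) * (w i : ℂ) = 0 := by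
    rw [h3, mul_zero]
  simp only [Omega, hD, Fin.sum_univ_four, Real.norm_eq_abs, sq_abs] at h4 ⊢
  push_cast
  linear_combination h4

lemma norm_fderiv_tangent_le (f : Sp → ℂ) {x w : Sp} (hw : inner ℝ x w = 0) :
    ‖x‖ * ‖fderiv ℝ f x w‖ ≤ 16 * ‖w‖ * √(angularEnergy f x) := by
  rcases eq_or_ne x 0 with rfl | hx
  · simp only [norm_zero, zero_mul]; positivity
  have hx' : 0 < ‖x‖ := norm_pos_iff.2 hx
  have h := congrArg norm (norm_sq_mul_fderiv f hw)
  have hb : ‖∑ i, ∑ j, ((x i * w j : ℝ) : ℂ) * Omega i j f x‖ ≤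
      ∑ _i : Fin 4, ∑ _j : Fin 4, ‖x‖ * ‖w‖ * √(angularEnergy f x) := by
    refine norm_sum_le_of_le _ fun i _ => norm_sum_le_of_le _ fun j _ => ?_
    rw [norm_mul, Complex.norm_real, norm_mul]
    gcongr
    · exact PiLp.norm_apply_le x i
    · exact PiLp.norm_apply_le w j
    · exact norm_Omega_le_sqrt_angularEnergy f x i j
  rw [← h, norm_mul, Complex.norm_real, Real.norm_of_nonneg (by positivity)] at hb
  simp only [Finset.sum_const, Finset.card_univ, Fintype.card_fin, nsmul_eq_mul] at hb
  refine le_of_mul_le_mul_left ?_ hx'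
  push_cast at hb
  linarith

/-- The gnomonic parametrisation of half of the sphere of radius `|r|`. -/
def gnomonic (k : Fin 4) (r : ℝ) (y : Fin 3 → ℝ) : Sp :=
  r • ‖tangentPlane k y‖⁻¹ • tangentPlane k y

lemma norm_gnomonic (k : Fin 4) (r : ℝ) (y : Fin 3 → ℝ) : ‖gnomonic k r y‖ = |r| := by
  simp [gnomonic, norm_smul, (norm_tangentPlane_pos k y).ne']

lemma hasFDerivAt_tangentPlane (k : Fin 4) (y : Fin 3 → ℝ) :
    HasFDerivAt (tangentPlane k) (tangentEmbedding k) y := by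
  rw [funext (tangentPlane_eq k)]
  exact (tangentEmbedding k).hasFDerivAt.const_add _

lemma contDiff_tangentPlane (k : Fin 4) : ContDiff ℝ 1 (tangentPlane k) := by
  rw [funext (tangentPlane_eq k)]
  exact contDiff_const.add (tangentEmbedding k).contDiff

lemma contDiff_inv_norm_tangentPlane (k : Fin 4) :
    ContDiff ℝ 1 fun y => ‖tangentPlane k y‖⁻¹ :=
  ((contDiff_tangentPlane k).norm ℝ fun y => norm_pos_iff.1 (norm_tangentPlane_pos k y)).inv
    fun y => (norm_tangentPlane_pos k y).ne'

lemma contDiff_gnomonic (k : Fin 4) (r : ℝ) : ContDiff ℝ 1 (gnomonic k r) :=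
  ((contDiff_inv_norm_tangentPlane k).smul (contDiff_tangentPlane k)).const_smul r

lemma inner_gnomonic_fderiv (k : Fin 4) (r : ℝ) (y v : Fin 3 → ℝ) :
    inner ℝ (gnomonic k r y) (fderiv ℝ (gnomonic k r) y v) = 0 := by
  have hd := ((contDiff_gnomonic k r).differentiable one_ne_zero y).hasFDerivAt
  have h1 := hd.norm_sq
  simp only [norm_gnomonic] at h1
  have h2 := congrArg (fun L => L v) (h1.unique (hasFDerivAt_const _ _))
  simpa using h2

lemma norm_fderiv_gnomonic_le (k : Fin 4) (r : ℝ) (y v : Fin 3 → ℝ) :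
    ‖fderiv ℝ (gnomonic k r) y v‖ ≤ 2 * |r| * ‖v‖ := by
  have hp := norm_tangentPlane_pos k y
  obtain ⟨c, hc⟩ : ∃ c : ℝ, fderiv ℝ (gnomonic k r) y v =
      (r * ‖tangentPlane k y‖⁻¹) • tangentEmbedding k v + c • gnomonic k r y := by
    rcases eq_or_ne r 0 with rfl | hr
    · have : gnomonic k 0 = fun _ => 0 := by ext; simp [gnomonic]
      exact ⟨0, by simp [this]⟩
    have h1 := ((contDiff_inv_norm_tangentPlane k).differentiable one_ne_zero y).hasFDerivAt
    have h2 := (h1.smul (hasFDerivAt_tangentPlane k y)).const_smul r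
    have h3 : HasFDerivAt (gnomonic k r) _ y := h2
    rw [h3.fderiv]
    refine ⟨fderiv ℝ (fun y => ‖tangentPlane k y‖⁻¹) y v * ‖tangentPlane k y‖, ?_⟩
    simp only [gnomonic, _root_.smul_apply, _root_.add_apply,
      ContinuousLinearMap.smulRight_apply, smul_add, smul_smul]
    congr 2
    field_simp
  have ho := inner_gnomonic_fderiv k r y v
  set w := fderiv ℝ (gnomonic k r) y v
  have hw : ‖w‖ * ‖w‖ ≤ (2 * |r| * ‖v‖) * ‖w‖ := by
    have e : ‖w‖ * ‖w‖ = inner ℝ ((r * ‖tangentPlane k y‖⁻¹) • tangentEmbedding k v) w := by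
      rw [← real_inner_self_eq_norm_mul_norm]
      nth_rewrite 1 [hc]
      rw [inner_add_left, inner_smul_left _ w c, ho]
      simp
    rw [e]
    refine (real_inner_le_norm _ _).trans ?_
    gcongr
    rw [norm_smul, norm_mul, norm_inv, norm_norm, Real.norm_eq_abs]
    have hi : ‖tangentPlane k y‖⁻¹ ≤ 1 := inv_le_one_of_one_le₀ (one_le_norm_tangentPlane k y)
    calc |r| * ‖tangentPlane k y‖⁻¹ * ‖tangentEmbedding k v‖ ≤ |r| * 1 * (2 * ‖v‖) := by
          gcongr; exact norm_tangentEmbedding_le k v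
      _ = _ := by ring
  rcases (norm_nonneg w).eq_or_lt with h0 | h0
  · rw [← h0]; positivity
  · exact le_of_mul_le_mul_right hw h0

lemma norm_fderiv_comp_gnomonic_le {f : Sp → ℂ} (hf : ContDiff ℝ 1 f) (k : Fin 4) {r : ℝ}
    (hr : r ≠ 0) (y : Fin 3 → ℝ) :
    ‖fderiv ℝ (f ∘ gnomonic k r) y‖ ≤ 32 * √(angularEnergy f (gnomonic k r y)) := by
  refine ContinuousLinearMap.opNorm_le_bound _ (by positivity) fun v => ?_
  rw [fderiv_comp _ (hf.differentiable one_ne_zero _)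
    ((contDiff_gnomonic k r).differentiable one_ne_zero y), ContinuousLinearMap.comp_apply]
  have h := norm_fderiv_tangent_le f (inner_gnomonic_fderiv k r y v)
  rw [norm_gnomonic] at h
  refine le_of_mul_le_mul_left (h.trans ?_) (abs_pos.2 hr)
  calc _ ≤ 16 * (2 * |r| * ‖v‖) * √(angularEnergy f (gnomonic k r y)) := by
        gcongr; exact norm_fderiv_gnomonic_le k r y v
    _ = _ := by ring

/-- The Gagliardo–Nirenberg–Sobolev inequality `W^{1,2}(ℝ³) ⊂ L⁶(ℝ³)` in integral form. -/
lemma exists_lintegral_pow_six_le :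
    ∃ C : ℝ≥0∞, C ≠ ∞ ∧ ∀ u : (Fin 3 → ℝ) → ℂ, ContDiff ℝ 1 u → HasCompactSupport u →
      ∫⁻ y, ‖u y‖ₑ ^ 6 ≤ C * (∫⁻ y, ‖fderiv ℝ u y‖ₑ ^ 2) ^ 3 := by
  refine ⟨(SNormLESNormFDerivOfEqConst ℂ (volume : Measure (Fin 3 → ℝ)) 2 : ℝ≥0∞) ^ 6,
    by simp, fun u hu h2u => ?_⟩
  have h := eLpNorm_le_eLpNorm_fderiv_of_eq (volume : Measure (Fin 3 → ℝ)) hu h2u (p := 2)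
    (p' := 6) (by norm_num) (by simp) (by simp; norm_num)
  have h6 := eLpNorm_nnreal_pow_eq_lintegral (f := u) (μ := volume) (p := 6) (by norm_num)
  have h2 := eLpNorm_nnreal_pow_eq_lintegral (f := fderiv ℝ u) (μ := volume) (p := 2) (by norm_num)
  simp only [NNReal.coe_ofNat, ENNReal.rpow_ofNat] at h6 h2
  rw [← h6, ← h2, ← pow_mul, ← mul_pow]
  gcongr
  exact h

lemma continuous_Omega {f : Sp → ℂ} (hf : ContDiff ℝ 1 f) (i j : Fin 4) :
    Continuous (Omega i j f) := by
  have h := hf.continuous_fderiv one_ne_zero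
  unfold Omega
  fun_prop

lemma continuous_angularEnergy {f : Sp → ℂ} (hf : ContDiff ℝ 1 f) :
    Continuous (angularEnergy f) := by
  have h0 := hf.continuous
  unfold angularEnergy
  refine (h0.norm.pow 2).add
    (continuous_finsetSum _ fun i _ => continuous_finsetSum _ fun j _ => ?_)
  split_ifs
  · exact (continuous_Omega hf i j).norm.pow 2
  · exact continuous_const

/-- The Sobolev inequality on the spherical cap around a coordinate vector. -/
lemma exists_lintegral_cap_pow_six_le :
    ∃ C : ℝ≥0∞, C ≠ ∞ ∧ ∀ (k : Fin 4) (f : Sp → ℂ), ContDiff ℝ 1 f → ∀ r : ℝ, r ≠ 0 →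
      ∫⁻ θ : Metric.sphere (0 : Sp) 1,
          {x : Sp | 1 / 2 ≤ x k}.indicator (fun x => ‖f (r • x)‖ₑ ^ 6) θ ∂sphMeasure ≤
        C * (∫⁻ θ : Metric.sphere (0 : Sp) 1,
          ENNReal.ofReal (angularEnergy f (r • (θ : Sp))) ∂sphMeasure) ^ 3 := by
  obtain ⟨C, hC, hCu⟩ := exists_lintegral_pow_six_le
  let χ : ContDiffBump (0 : Fin 3 → ℝ) := ⟨2, 3, by norm_num, by norm_num⟩
  obtain ⟨M, hM⟩ := (χ.contDiff (n := 1)).continuous_fderiv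
    one_ne_zero |>.bounded_above_of_compact_support (χ.hasCompactSupport.fderiv ℝ)
  have hM0 : 0 ≤ M := (norm_nonneg _).trans (hM 0)
  set K : ℝ := (M + 32) ^ 2 * 7 ^ 4
  refine ⟨C * ENNReal.ofReal K ^ 3, ENNReal.mul_ne_top hC (by simp), fun k f hf r hr => ?_⟩
  have hfG : ContDiff ℝ 1 (f ∘ gnomonic k r) := hf.comp (contDiff_gnomonic k r)
  set u : (Fin 3 → ℝ) → ℂ := fun y => χ y • f (gnomonic k r y) with hu_def
  have hu : ContDiff ℝ 1 u := χ.contDiff.smul hfG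
  have h2u : HasCompactSupport u := χ.hasCompactSupport.smul_right
  have hDu : ∀ y, ‖fderiv ℝ u y‖ ≤ (M + 32) * √(angularEnergy f (gnomonic k r y)) := by
    intro y
    have hχ := (χ.contDiff (n := 1)).differentiable one_ne_zero y
    have e : fderiv ℝ u y = χ y • fderiv ℝ (f ∘ gnomonic k r) y +
        (fderiv ℝ χ y).smulRight (f (gnomonic k r y)) :=
      fderiv_fun_smul hχ (hfG.differentiable one_ne_zero y)
    rw [e]
    refine (norm_add_le _ _).trans ?_
    rw [norm_smul, ContinuousLinearMap.norm_smulRight_apply, Real.norm_of_nonneg χ.nonneg]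
    calc _ ≤ 1 * (32 * √(angularEnergy f (gnomonic k r y))) +
          M * √(angularEnergy f (gnomonic k r y)) := by
          gcongr
          · exact χ.le_one
          · exact norm_fderiv_comp_gnomonic_le hf k hr y
          · exact hM y
          · exact norm_le_sqrt_angularEnergy f _
      _ = _ := by ring
  have hDu2 : ∀ y, ‖fderiv ℝ u y‖ₑ ^ 2 ≤ ENNReal.ofReal K *
      (ENNReal.ofReal (angularEnergy f (gnomonic k r y)) *
        ENNReal.ofReal (‖tangentPlane k y‖⁻¹ ^ 4)) := by
    intro y
    by_cases hy : y ∈ tsupport u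
    · have hy3 : ‖y‖ ≤ 3 := by
        have : y ∈ tsupport χ := tsupport_smul_subset_left (χ : (Fin 3 → ℝ) → ℝ) _ hy
        rw [χ.tsupport_eq] at this
        simpa [χ] using this
      have hp := norm_tangentPlane_pos k y
      have hp7 : ‖tangentPlane k y‖ ≤ 7 := by linarith [norm_tangentPlane_le k y]
      have hA := angularEnergy_nonneg f (gnomonic k r y)
      rw [← ENNReal.ofReal_mul hA, ← ENNReal.ofReal_mul (by positivity),
        ← ofReal_norm, ← ENNReal.ofReal_pow (norm_nonneg _)]
      refine ENNReal.ofReal_le_ofReal ?_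
      have h7 : 1 ≤ 7 ^ 4 * ‖tangentPlane k y‖⁻¹ ^ 4 := by
        rw [← mul_pow]
        refine one_le_pow₀ ?_
        rw [← div_eq_mul_inv, one_le_div hp]
        exact hp7
      calc _ ≤ ((M + 32) * √(angularEnergy f (gnomonic k r y))) ^ 2 := by
            gcongr; exact hDu y
        _ = (M + 32) ^ 2 * angularEnergy f (gnomonic k r y) * 1 := by
            rw [mul_pow, Real.sq_sqrt hA, mul_one]
        _ ≤ (M + 32) ^ 2 * angularEnergy f (gnomonic k r y) *
            (7 ^ 4 * ‖tangentPlane k y‖⁻¹ ^ 4) := by gcongr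
        _ = _ := by ring
    · have : fderiv ℝ u y = 0 := image_eq_zero_of_notMem_tsupport
        fun h => hy (tsupport_fderiv_subset ℝ h)
      rw [← ofReal_norm, this, norm_zero, ENNReal.ofReal_zero, zero_pow two_ne_zero]
      exact zero_le
  have hE : Measurable fun x => ENNReal.ofReal (angularEnergy f x) :=
    (continuous_angularEnergy hf).measurable.ennreal_ofReal
  have hEr : Measurable fun x : Sp => ENNReal.ofReal (angularEnergy f (r • x)) :=
    hE.comp (measurable_const_smul r)
  have hgrad : ∫⁻ y, ‖fderiv ℝ u y‖ₑ ^ 2 ≤ ENNReal.ofReal K *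
      ∫⁻ θ : Metric.sphere (0 : Sp) 1,
        ENNReal.ofReal (angularEnergy f (r • (θ : Sp))) ∂sphMeasure := by
    refine (lintegral_mono hDu2).trans ?_
    rw [lintegral_const_mul' _ _ ENNReal.ofReal_ne_top]
    gcongr
    refine (lintegral_gnomonic k hEr).trans_le (lintegral_mono fun θ => ?_)
    exact Set.indicator_le_self _ _ _
  have hS : MeasurableSet {x : Sp | 1 / 2 ≤ x k} := measurableSet_le measurable_const (by fun_prop)
  have hg : Measurable ({x : Sp | 1 / 2 ≤ x k}.indicator (fun x => ‖f (r • x)‖ₑ ^ 6)) :=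
    (((hf.continuous.measurable.comp (measurable_const_smul r)).enorm).pow_const 6).indicator hS
  have hcap : ∫⁻ θ : Metric.sphere (0 : Sp) 1,
      {x : Sp | 1 / 2 ≤ x k}.indicator (fun x => ‖f (r • x)‖ₑ ^ 6) θ ∂sphMeasure ≤
      ∫⁻ y, ‖u y‖ₑ ^ 6 := by
    calc _ = ∫⁻ θ : Metric.sphere (0 : Sp) 1, {x : Sp | 0 < x k}.indicator
          ({x : Sp | 1 / 2 ≤ x k}.indicator (fun x => ‖f (r • x)‖ₑ ^ 6)) θ ∂sphMeasure := by
          rw [Set.indicator_indicator, Set.inter_eq_right.2]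
          intro x hx
          simp only [Set.mem_ofPred_eq] at hx ⊢
          linarith
      _ = _ := (lintegral_gnomonic k hg).symm
      _ ≤ _ := by
          refine lintegral_mono fun y => ?_
          have hp := norm_tangentPlane_pos k y
          by_cases hy : 1 / 2 ≤ (‖tangentPlane k y‖⁻¹ • tangentPlane k y) k
          · rw [Set.indicator_of_mem (by exact hy)]
            have hy2 : ‖tangentPlane k y‖ ≤ 2 := by
              rw [PiLp.smul_apply, tangentPlane_apply_self, smul_eq_mul, mul_one,
                one_div, inv_le_inv₀ (by norm_num) hp] at hy
              exact hy
            have hχ : χ y = 1 := χ.one_of_mem_closedBall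
              (by simpa [χ] using (norm_le_norm_tangentPlane k y).trans hy2)
            have h1 : ENNReal.ofReal (‖tangentPlane k y‖⁻¹ ^ 4) ≤ 1 := by
              rw [ENNReal.ofReal_le_one]
              exact pow_le_one₀ (by positivity)
                (inv_le_one_of_one_le₀ (one_le_norm_tangentPlane k y))
            simp only [hu_def, hχ, one_smul]
            exact mul_le_of_le_one_right' h1
          · rw [Set.indicator_of_notMem (by exact hy), zero_mul]
            exact zero_le
  calc _ ≤ _ := hcap
    _ ≤ _ := hCu u hu h2u
    _ ≤ C * (ENNReal.ofReal K * ∫⁻ θ : Metric.sphere (0 : Sp) 1,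
        ENNReal.ofReal (angularEnergy f (r • (θ : Sp))) ∂sphMeasure) ^ 3 := by gcongr
    _ = _ := by rw [mul_pow, mul_assoc]

lemma exists_half_le_abs (θ : Metric.sphere (0 : Sp) 1) : ∃ k, 1 / 2 ≤ |(θ : Sp) k| := by
  by_contra! h
  have h1 : ‖(θ : Sp)‖ = 1 := by simp
  have h2 := EuclideanSpace.norm_sq_eq (θ : Sp)
  have h3 : ∀ k, ‖(θ : Sp) k‖ ^ 2 < (1 / 2) ^ 2 := fun k => by
    have := h k
    rw [Real.norm_eq_abs]
    gcongr
  rw [h1, Fin.sum_univ_four] at h2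
  linarith [h3 0, h3 1, h3 2, h3 3]

/-- The Sobolev inequality on spheres, with a constant that does not depend on the radius. -/
lemma exists_lintegral_sphere_pow_six_le :
    ∃ C : ℝ≥0∞, C ≠ ∞ ∧ ∀ (f : Sp → ℂ), ContDiff ℝ 1 f → ∀ r : ℝ, r ≠ 0 →
      ∫⁻ θ : Metric.sphere (0 : Sp) 1, ‖f (r • (θ : Sp))‖ₑ ^ 6 ∂sphMeasure ≤
        C * (∫⁻ θ : Metric.sphere (0 : Sp) 1,
          ENNReal.ofReal (angularEnergy f (r • (θ : Sp))) ∂sphMeasure) ^ 3 := by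
  obtain ⟨C, hC, hcap⟩ := exists_lintegral_cap_pow_six_le
  refine ⟨4 * (C + C), by finiteness, fun f hf r hr => ?_⟩
  set I := ∫⁻ θ : Metric.sphere (0 : Sp) 1,
    ENNReal.ofReal (angularEnergy f (r • (θ : Sp))) ∂sphMeasure
  let g (k : Fin 4) (s : ℝ) : Sp → ℝ≥0∞ :=
    {x : Sp | 1 / 2 ≤ x k}.indicator (fun x => ‖f (s • x)‖ₑ ^ 6)
  have hg : ∀ k s, Measurable (g k s) := fun k s =>
    (((hf.continuous.measurable.comp (measurable_const_smul s)).enorm).pow_const 6).indicator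
      (measurableSet_le measurable_const (by fun_prop))
  have hneg : ∫⁻ θ : Metric.sphere (0 : Sp) 1,
      ENNReal.ofReal (angularEnergy f ((-r) • (θ : Sp))) ∂sphMeasure = I := by
    have := lintegral_sphere_neg (h := fun x => ENNReal.ofReal (angularEnergy f (r • x)))
      ((continuous_angularEnergy hf).comp (continuous_const_smul r)).measurable.ennreal_ofReal
    simpa only [smul_neg, neg_smul] using this
  have hle : ∀ θ : Metric.sphere (0 : Sp) 1,
      ‖f (r • (θ : Sp))‖ₑ ^ 6 ≤ ∑ k, (g k r θ + g k (-r) (-θ)) := by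
    intro θ
    obtain ⟨k, hk⟩ := exists_half_le_abs θ
    refine le_trans ?_ (Finset.single_le_sum (f := fun k => g k r θ + g k (-r) (-θ))
      (fun _ _ => zero_le) (Finset.mem_univ k))
    rcases le_abs.1 hk with h | h
    · refine le_add_of_le_of_nonneg ?_ zero_le
      simp only [g]
      rw [Set.indicator_of_mem (by exact h)]
    · refine le_add_of_nonneg_of_le zero_le ?_
      simp only [g]
      rw [Set.indicator_of_mem (by exact h), neg_smul, smul_neg, neg_neg]
  calc _ ≤ ∫⁻ θ : Metric.sphere (0 : Sp) 1, ∑ k, (g k r θ + g k (-r) (-θ)) ∂sphMeasure :=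
        lintegral_mono hle
    _ = ∑ k, (∫⁻ θ : Metric.sphere (0 : Sp) 1, g k r θ ∂sphMeasure +
          ∫⁻ θ : Metric.sphere (0 : Sp) 1, g k (-r) θ ∂sphMeasure) := by
        rw [lintegral_finsetSum _ fun k _ => by fun_prop]
        refine Finset.sum_congr rfl fun k _ => ?_
        rw [lintegral_add_left (by fun_prop), lintegral_sphere_neg (hg k (-r))]
    _ ≤ ∑ _k : Fin 4, (C * I ^ 3 + C * I ^ 3) := by
        gcongr with k
        · exact hcap k f hf r hr
        · exact (hcap k f hf (-r) (neg_ne_zero.2 hr)).trans_eq (by rw [hneg])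
    _ = _ := by
        simp only [Finset.sum_const, Finset.card_univ, Fintype.card_fin, nsmul_eq_mul]
        push_cast
        ring

lemma lintegral_angularEnergy {f : Sp → ℂ} (hf : ContDiff ℝ 1 f) :
    ∫⁻ x, ENNReal.ofReal (angularEnergy f x) = eLpNorm f 2 volume ^ 2 +
      ∑ i : Fin 4, ∑ j : Fin 4, if i < j then eLpNorm (Omega i j f) 2 volume ^ 2 else 0 := by
  have hL : ∀ g : Sp → ℂ, eLpNorm g 2 volume ^ 2 = ∫⁻ x, ‖g x‖ₑ ^ 2 := fun g => by
    simpa using eLpNorm_nnreal_pow_eq_lintegral (f := g) (μ := volume) (p := 2) (by norm_num)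
  have hm := fun i j => (continuous_Omega hf i j).measurable
  have hm' : ∀ i j : Fin 4, Measurable fun x =>
      if i < j then ‖Omega i j f x‖ₑ ^ 2 else 0 := fun i j => by
    split_ifs
    · exact (hm i j).enorm.pow_const 2
    · exact measurable_const
  have e : ∀ x, ENNReal.ofReal (angularEnergy f x) = ‖f x‖ₑ ^ 2 +
      ∑ i : Fin 4, ∑ j : Fin 4, if i < j then ‖Omega i j f x‖ₑ ^ 2 else 0 := by
    intro x
    have hn : ∀ i j : Fin 4, 0 ≤ if i < j then ‖Omega i j f x‖ ^ 2 else 0 := fun i j => by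
      split_ifs <;> positivity
    rw [angularEnergy, ENNReal.ofReal_add (by positivity)
      (Finset.sum_nonneg fun i _ => Finset.sum_nonneg fun j _ => hn i j),
      ENNReal.ofReal_sum_of_nonneg fun i _ => Finset.sum_nonneg fun j _ => hn i j]
    congr 1
    · rw [ENNReal.ofReal_pow (norm_nonneg _), ofReal_norm]
    · refine Finset.sum_congr rfl fun i _ => ?_
      rw [ENNReal.ofReal_sum_of_nonneg fun j _ => hn i j]
      refine Finset.sum_congr rfl fun j _ => ?_
      split_ifs
      · rw [ENNReal.ofReal_pow (norm_nonneg _), ofReal_norm]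
      · simp
  simp_rw [e, hL]
  rw [lintegral_add_left (hf.continuous.measurable.enorm.pow_const 2),
    lintegral_finsetSum _ fun i _ => Finset.measurable_fun_sum _ fun j _ => hm' i j]
  congr 1
  refine Finset.sum_congr rfl fun i _ => ?_
  rw [lintegral_finsetSum _ fun j _ => hm' i j]
  refine Finset.sum_congr rfl fun j _ => ?_
  split_ifs <;> simp

/-- (Weighted radial–spherical Sobolev estimate.)  There is an absolute
constant `C` such that for every Schwartz `f : ℝ⁴ → ℂ`,
`∫₀^∞ (∫_{S³} |f(rθ)|⁶ dσ(θ))^{1/3} r³ dr ≤ C (‖f‖_{L²}² + Σ_{i<j} ‖Ω_{ij}f‖_{L²}²)`. -/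
theorem statement11 :
    ∃ C : ℝ, 0 < C ∧ ∀ f : SchwartzMap Sp ℂ,
      (∫⁻ r in Set.Ioi (0:ℝ),
          ((∫⁻ θ : Metric.sphere (0 : Sp) 1,
              (‖f (r • (θ : Sp))‖₊ : ℝ≥0∞) ^ (6:ℝ) ∂sphMeasure) ^ (1/3 : ℝ)) *
            ENNReal.ofReal (r ^ 3)) ≤
        ENNReal.ofReal C *
          (eLpNorm (⇑f) 2 volume ^ 2 +
            ∑ i : Fin 4, ∑ j : Fin 4,
              if i < j then eLpNorm (Omega i j (⇑f)) 2 volume ^ 2 else 0) := by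
  obtain ⟨C, hC, hsph⟩ := exists_lintegral_sphere_pow_six_le
  refine ⟨(C ^ (1 / 3 : ℝ)).toReal + 1, by positivity, fun f => ?_⟩
  have hf : ContDiff ℝ 1 f := f.smooth 1
  have hC3 : C ^ (1 / 3 : ℝ) ≤ ENNReal.ofReal ((C ^ (1 / 3 : ℝ)).toReal + 1) :=
    (ENNReal.le_ofReal_iff_toReal_le (by finiteness) (by positivity)).2 (by linarith)
  rw [← lintegral_angularEnergy hf, lintegral_eq_lintegral_polar
    (continuous_angularEnergy hf).measurable.ennreal_ofReal,
    ← lintegral_const_mul' _ _ ENNReal.ofReal_ne_top]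
  refine setLIntegral_mono' measurableSet_Ioi fun r hr => ?_
  rw [← mul_assoc]
  gcongr
  have h := hsph f hf r (ne_of_gt hr)
  simp only [ENNReal.rpow_ofNat]
  refine (ENNReal.rpow_le_rpow h (by norm_num : (0:ℝ) ≤ 1 / 3)).trans ?_
  rw [ENNReal.mul_rpow_of_nonneg _ _ (by norm_num), ← ENNReal.rpow_natCast, ← ENNReal.rpow_mul]
  norm_num only [Nat.cast_ofNat, ENNReal.rpow_one]
  gcongr

end
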